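/- Let f : I ⊆ [0, ∞) → ℝ be differentiable on I°, a, b ∈ I with a < b, and f' integrable on [a, b]. Let q ≥ 1. If |f'|^q is convex on [a, b], then |f((a+b)/2) − (1/(b−a)) ∫_a^b f(u) du| ≤ ((b−a)/8) · (1/3)^{1/q} · [ (|f'(a)|^q + 3|f'(b)|^q)^{1/q} + (3|f'(a)|^q + |f'(b)|^q)^{1/q} ]. -/

import Mathlib

open Set MeasureTheory intervalIntegral

/-- Midpoint-type estimate on a half interval, for a derivative bounded by an affine function.
The function need not be continuous at the left endpoint. -/
lemma integrable_and_abs_sub_integral_le_of_abs_deriv_le_affine {f : ℝ → ℝ} {a m k₀ k₁ : ℝ}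
    (ham : a < m) (hf : ∀ x ∈ Ioc a m, DifferentiableAt ℝ f x)
    (hbd : ∀ x ∈ Ioc a m, |deriv f x| ≤ k₀ + k₁ * (x - a)) :
    IntervalIntegrable f volume a m ∧
      |(m - a) * f m - ∫ u in a..m, f u| ≤ k₀ * (m - a) ^ 2 / 2 + k₁ * (m - a) ^ 3 / 3 := by
  set P : ℝ → ℝ := fun x => k₀ * (x - a) + k₁ * (x - a) ^ 2 / 2 with hP
  have hPd : ∀ x, HasDerivAt P (k₀ + k₁ * (x - a)) x := by
    intro x
    have h := (hasDerivAt_id x).sub_const a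
    refine ((h.const_mul k₀).add (((h.pow 2).const_mul k₁).div_const 2)).congr_deriv ?_
    simp
    ring
  have hPc : Continuous P := by fun_prop
  have key : ∀ u ∈ Ioc a m, ‖f m - f u‖ ≤ P m - P u := by
    intro u hu
    have hmem : ∀ x ∈ Icc u m, x ∈ Ioc a m := fun x hx => ⟨hu.1.trans_le hx.1, hx.2⟩
    refine image_norm_le_of_norm_deriv_right_le_deriv_boundary (f := fun x => f x - f u)
      (f' := deriv f) (a := u) (b := m) (B := fun x => P x - P u)
      (B' := fun x => k₀ + k₁ * (x - a)) ?_ ?_ ?_ ?_ ?_ (right_mem_Icc.2 hu.2)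
    · exact fun x hx => ((hf x (hmem x hx)).continuousAt.sub
        continuousAt_const).continuousWithinAt
    · exact fun x hx =>
        ((hf x (hmem x (Ico_subset_Icc_self hx))).hasDerivAt.sub_const _).hasDerivWithinAt
    · simp
    · exact fun x => (hPd x).sub_const _
    · exact fun x hx => hbd x (hmem x (Ico_subset_Icc_self hx))
  have hPint : IntervalIntegrable (fun u => P m - P u) volume a m :=
    (continuous_const.sub hPc).intervalIntegrable _ _
  have hdint : IntervalIntegrable (fun u => f m - f u) volume a m := by
    refine hPint.mono_fun ?_ ?_
    · rw [uIoc_of_le ham.le]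
      exact ContinuousOn.aestronglyMeasurable (fun x hx =>
        (continuousAt_const.sub (hf x hx).continuousAt).continuousWithinAt) measurableSet_Ioc
    · rw [uIoc_of_le ham.le]
      filter_upwards [ae_restrict_mem measurableSet_Ioc] with u hu
      exact (key u hu).trans (le_abs_self _)
  have hfint : IntervalIntegrable f volume a m := by
    simpa using (intervalIntegrable_const (c := f m)).sub hdint
  refine ⟨hfint, ?_⟩
  have hle : ‖∫ u in a..m, (f m - f u)‖ ≤ ∫ u in a..m, (P m - P u) :=
    norm_integral_le_of_norm_le ham.le (Filter.Eventually.of_forall key) hPint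
  have hleft : ∫ u in a..m, (f m - f u) = (m - a) * f m - ∫ u in a..m, f u := by
    rw [integral_sub intervalIntegrable_const hfint]
    simp
  have hright : ∫ u in a..m, (P m - P u)
      = k₀ * (m - a) ^ 2 / 2 + k₁ * (m - a) ^ 3 / 3 := by
    have hprim : ∀ x ∈ uIcc a m, HasDerivAt
        (fun x => P m * (x - a) - (k₀ * (x - a) ^ 2 / 2 + k₁ * (x - a) ^ 3 / 6))
        (P m - P x) x := by
      intro x _
      have h := (hasDerivAt_id x).sub_const a
      refine ((h.const_mul (P m)).sub ((((h.pow 2).const_mul k₀).div_const 2).add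
        (((h.pow 3).const_mul k₁).div_const 6))).congr_deriv ?_
      simp [hP]
      ring
    rw [integral_eq_sub_of_hasDerivAt hprim hPint]
    simp only [hP]
    ring
  rwa [hleft, hright, Real.norm_eq_abs] at hle

/-- The concave function `x ↦ x ^ p`, `0 ≤ p ≤ 1`, lies below its tangent line at `c`. -/
lemma rpow_le_tangent {x c p : ℝ} (hx : 0 ≤ x) (hc : 0 < c) (hp0 : 0 ≤ p) (hp1 : p ≤ 1) :
    x ^ p ≤ c ^ p * (1 + p * (x / c - 1)) := by
  have hxc : 0 ≤ x / c := by positivity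
  have h := rpow_one_add_le_one_add_mul_self (s := x / c - 1) (by linarith) hp0 hp1
  have hx' : x = c * (x / c) := by field_simp
  calc x ^ p = c ^ p * (x / c) ^ p := by rw [← Real.mul_rpow hc.le hxc, ← hx']
    _ ≤ c ^ p * (1 + p * (x / c - 1)) := by
      gcongr
      simpa using h

/-- Estimate on the left half of `[a, b]` when `|f'| ^ q` lies below the chord from `(a, A)` to
`(b, B)`. -/
lemma integrable_and_abs_sub_integral_le_of_abs_deriv_rpow_le {f : ℝ → ℝ} {a b q A B : ℝ}
    (hab : a < b) (hq : 1 ≤ q) (hA : 0 ≤ A) (hB : 0 ≤ B)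
    (hf : ∀ x ∈ Ioc a ((a + b) / 2), DifferentiableAt ℝ f x)
    (hbd : ∀ x ∈ Ioc a ((a + b) / 2),
      |deriv f x| ^ q ≤ A + (B - A) * ((x - a) / (b - a))) :
    IntervalIntegrable f volume a ((a + b) / 2) ∧
      |(b - a) / 2 * f ((a + b) / 2) - ∫ u in a..(a + b) / 2, f u|
        ≤ (b - a) ^ 2 / 8 * ((2 * A + B) / 3) ^ (1 / q) := by
  have hq0 : 0 < q := by linarith
  have hh : 0 < b - a := by linarith
  have hp0 : 0 < 1 / q := by positivity
  have hp1 : 1 / q ≤ 1 := by rw [div_le_one hq0]; exact hq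
  have hroot : ∀ x ∈ Ioc a ((a + b) / 2),
      |deriv f x| ≤ (A + (B - A) * ((x - a) / (b - a))) ^ (1 / q) := by
    intro x hx
    have h := Real.rpow_le_rpow (by positivity) (hbd x hx) hp0.le
    rwa [← Real.rpow_mul (abs_nonneg _), mul_one_div_cancel hq0.ne', Real.rpow_one] at h
  have hm : (a + b) / 2 - a = (b - a) / 2 := by ring
  have ham : a < (a + b) / 2 := by linarith
  rcases (show 0 ≤ (2 * A + B) / 3 by positivity).eq_or_lt with hc | hc
  · have hA0 : A = 0 := by linarith
    have hB0 : B = 0 := by linarith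
    subst hA0 hB0
    have h := integrable_and_abs_sub_integral_le_of_abs_deriv_le_affine (k₀ := 0) (k₁ := 0) ham hf
      (fun x hx => by simpa [Real.zero_rpow (inv_pos.2 hq0).ne'] using hroot x hx)
    rw [hm] at h
    refine ⟨h.1, h.2.trans (le_of_eq ?_)⟩
    rw [← hc, Real.zero_rpow hp0.ne']
    ring
  · set c := (2 * A + B) / 3 with hcdef
    set p := 1 / q with hp
    have h := integrable_and_abs_sub_integral_le_of_abs_deriv_le_affine
      (k₀ := c ^ p * (1 + p * (A / c - 1))) (k₁ := c ^ p * p * ((B - A) / (c * (b - a)))) ham hf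
      (fun x hx => by
        refine (hroot x hx).trans ?_
        refine (rpow_le_tangent ((by positivity : 0 ≤ |deriv f x| ^ q).trans (hbd x hx))
          hc hp0.le hp1).trans (le_of_eq ?_)
        field_simp
        ring)
    rw [hm] at h
    refine ⟨h.1, h.2.trans (le_of_eq ?_)⟩
    have hBc : B = 3 * c - 2 * A := by rw [hcdef]; ring
    rw [hBc]
    field_simp
    ring

/-- Corollary 2.11: midpoint inequality when `|f'|^q` is convex on `[a, b]`, `q ≥ 1`. -/
theorem midpoint_convex_pow_deriv_power_mean
    (f : ℝ → ℝ) (I : Set ℝ) (hI : Convex ℝ I) (hI0 : I ⊆ Ici (0:ℝ))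
    (a b : ℝ) (ha : a ∈ I) (hb : b ∈ I) (hab : a < b)
    (hdiff : DifferentiableOn ℝ f (interior I))
    (hint : IntervalIntegrable (deriv f) volume a b)
    (q : ℝ) (hq : 1 ≤ q)
    (hconv : ConvexOn ℝ (Icc a b) (fun t => |deriv f t| ^ q)) :
    |f ((a + b) / 2) - (1 / (b - a)) * ∫ u in a..b, f u|
      ≤ (b - a) / 8 * ((1:ℝ) / 3) ^ (1 / q) *
        ((|deriv f a| ^ q + 3 * |deriv f b| ^ q) ^ (1 / q)
          + (3 * |deriv f a| ^ q + |deriv f b| ^ q) ^ (1 / q)) := by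
  have hh : 0 < b - a := by linarith
  have hq0 : 0 < q := by linarith
  have hIoo : ∀ x ∈ Ioo a b, DifferentiableAt ℝ f x := fun x hx =>
    hdiff.differentiableAt (isOpen_interior.mem_nhds
      (interior_mono (hI.ordConnected.out ha hb) (by rwa [interior_Icc])))
  set A := |deriv f a| ^ q with hAdef
  set B := |deriv f b| ^ q with hBdef
  have hA : 0 ≤ A := by positivity
  have hB : 0 ≤ B := by positivity
  have hchord : ∀ x ∈ Icc a b, |deriv f x| ^ q ≤ A + (B - A) * ((x - a) / (b - a)) := by
    intro x hx
    have h := hconv.2 (left_mem_Icc.2 hab.le) (right_mem_Icc.2 hab.le)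
      (div_nonneg (sub_nonneg.2 hx.2) hh.le) (div_nonneg (sub_nonneg.2 hx.1) hh.le)
      (by field_simp; ring)
    have hx' : ((b - x) / (b - a)) • a + ((x - a) / (b - a)) • b = x := by
      simp only [smul_eq_mul]
      field_simp
      ring
    rw [hx'] at h
    refine h.trans (le_of_eq ?_)
    simp only [smul_eq_mul, ← hAdef, ← hBdef]
    field_simp
    ring
  obtain ⟨hint₁, hle₁⟩ := integrable_and_abs_sub_integral_le_of_abs_deriv_rpow_le (f := f)
    hab hq hA hB (fun x hx => hIoo x ⟨hx.1, by linarith [hx.2]⟩)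
    (fun x hx => hchord x ⟨hx.1.le, by linarith [hx.2]⟩)
  have hreflect : ∀ x ∈ Ioc a ((a + b) / 2), a + b - x ∈ Ioo a b := fun x hx =>
    ⟨by linarith [hx.2], by linarith [hx.1]⟩
  obtain ⟨hint₂, hle₂⟩ := integrable_and_abs_sub_integral_le_of_abs_deriv_rpow_le
    (f := fun x => f (a + b - x)) hab hq hB hA
    (fun x hx => (hIoo _ (hreflect x hx)).comp x (by fun_prop))
    (fun x hx => by
      rw [deriv_comp_const_sub, abs_neg]
      refine (hchord _ (Ioo_subset_Icc_self (hreflect x hx))).trans (le_of_eq ?_)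
      field_simp
      ring)
  have hmid : a + b - (a + b) / 2 = (a + b) / 2 := by ring
  have hend : a + b - a = b := by ring
  have hint₂' : IntervalIntegrable f volume ((a + b) / 2) b := by
    have h := hint₂.comp_sub_left (a + b)
    simp only [sub_sub_cancel, hmid, hend] at h
    exact h.symm
  rw [integral_comp_sub_left, hmid, hend] at hle₂
  have hsplit := integral_add_adjacent_intervals hint₁ hint₂'
  have hthird : ∀ {x y : ℝ}, 0 ≤ x → x ≤ y →
      (x / 3) ^ (1 / q) ≤ ((1 : ℝ) / 3) ^ (1 / q) * y ^ (1 / q) := by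
    intro x y hx hxy
    rw [← Real.mul_rpow (by norm_num) (hx.trans hxy)]
    exact Real.rpow_le_rpow (by positivity) (by linarith) (by positivity)
  have h₁ := hthird (by positivity) (by linarith : 2 * A + B ≤ 3 * A + B)
  have h₂ := hthird (by positivity) (by linarith : 2 * B + A ≤ A + 3 * B)
  have heq : f ((a + b) / 2) - (1 / (b - a)) * ∫ u in a..b, f u
      = (((b - a) / 2 * f ((a + b) / 2) - ∫ u in a..(a + b) / 2, f u)
        + ((b - a) / 2 * f ((a + b) / 2) - ∫ u in (a + b) / 2..b, f u)) / (b - a) := by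
    rw [← hsplit]
    field_simp
    ring
  rw [heq, abs_div, abs_of_pos hh, div_le_iff₀ hh]
  refine (abs_add_le _ _).trans ((add_le_add hle₁ hle₂).trans ?_)
  have hfinal := mul_le_mul_of_nonneg_left (add_le_add h₁ h₂)
    (by positivity : 0 ≤ (b - a) ^ 2 / 8)
  linear_combination hfinal
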